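/- The standard rotation action of SO(2) on ℝ² is not strict: there exist smooth plots P, Q : ℝ → ℝ² with Q(u) in the SO(2)-orbit of P(u) for all u, such that no smooth map R : V → SO(2) on any neighborhood V of 0 satisfies Q(u) = R(u)·P(u) for all u ∈ V. Explicitly, P(u) = (0, e^{−1/u²}) and Q(u) = (0, sign(u)·e^{−1/u²}) (both defined as (0,0) at u = 0) witness this. -/

import Mathlib

open Real

/-- Membership in SO(2), as 2×2 real matrices. -/
def IsSO2 (M : Matrix (Fin 2) (Fin 2) ℝ) : Prop :=
  M.transpose * M = 1 ∧ M.det = 1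

/-- The flat function `e^{-1/u²}` (equal to `0` at `u = 0`). -/
noncomputable def flatExp (u : ℝ) : ℝ :=
  if u = 0 then 0 else Real.exp (-1 / u ^ 2)

/-- The plot `P(u) = (0, e^{-1/u²})`. -/
noncomputable def plotP (u : ℝ) : Fin 2 → ℝ := ![0, flatExp u]

/-- The plot `Q(u) = (0, sign(u)·e^{-1/u²})`. -/
noncomputable def plotQ (u : ℝ) : Fin 2 → ℝ := ![0, Real.sign u * flatExp u]

open Filter Topology Polynomial in
lemma flat_tendsto (p : ℝ[X]) :
    Tendsto (fun u : ℝ => p.eval u⁻¹ * flatExp u) (𝓝 0) (𝓝 0) := by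
  induction p using Polynomial.induction_on' with
  | add p q hp hq => simpa [add_mul] using hp.add hq
  | monomial n a =>
    have h1 : Tendsto (fun u : ℝ => u ^ 2) (𝓝 0) (𝓝 0) := by
      have : Continuous (fun u : ℝ => u ^ 2) := by fun_prop
      simpa using this.tendsto 0
    have h2 := (expNegInvGlue.tendsto_polynomial_inv_mul_zero (X ^ n)).comp h1
    have h3 : Tendsto (fun u : ℝ => a * u ^ n) (𝓝 0) (𝓝 (a * 0 ^ n)) := by
      have : Continuous (fun u : ℝ => a * u ^ n) := by fun_prop
      exact this.tendsto 0
    have h4 := h3.mul h2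
    rw [mul_zero] at h4
    refine h4.congr fun u => ?_
    by_cases hu : u = 0
    · simp [hu, flatExp, expNegInvGlue]
    · have hpos : ¬ u ^ 2 ≤ 0 := not_le.2 (by positivity)
      have he : expNegInvGlue (u ^ 2) = flatExp u := by
        rw [expNegInvGlue, flatExp, if_neg hpos, if_neg hu]
        congr 1
        ring
      simp only [Function.comp, he, eval_pow, eval_X, eval_monomial]
      have : u ^ n * ((u ^ 2)⁻¹) ^ n = u⁻¹ ^ n := by
        rw [← mul_pow]
        congr 1
        field_simp
      rw [← this]
      ring

open Filter Topology Polynomial in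
lemma flat_hasDerivAt (s : ℝ → ℝ) (hs : ∀ u ≠ 0, ∀ᶠ v in 𝓝 u, s v = s u)
    (hb : ∀ u, |s u| ≤ 1) (p : ℝ[X]) (x : ℝ) :
    HasDerivAt (fun u : ℝ => s u * (p.eval u⁻¹ * flatExp u))
      (s x * ((2 * X ^ 3 * p - X ^ 2 * derivative p).eval x⁻¹ * flatExp x)) x := by
  by_cases hx : x = 0
  · subst hx
    have h0 : flatExp 0 = 0 := by simp [flatExp]
    rw [h0, mul_zero, mul_zero, hasDerivAt_iff_tendsto_slope]
    have h1 := (flat_tendsto (p * X)).mono_left (inf_le_left : 𝓝[≠] (0 : ℝ) ≤ 𝓝 0)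
    refine squeeze_zero_norm (fun u => ?_) (tendsto_zero_iff_norm_tendsto_zero.1 h1)
    have : slope (fun u : ℝ => s u * (p.eval u⁻¹ * flatExp u)) 0 u
        = s u * ((p * X).eval u⁻¹ * flatExp u) := by
      simp [slope_def_field, div_eq_mul_inv, h0]
      ring
    rw [this, norm_mul]
    exact mul_le_of_le_one_left (norm_nonneg _) (hb u)
  · have he : HasDerivAt (fun u : ℝ => Real.exp (-(u⁻¹) ^ 2))
        (Real.exp (-(x⁻¹) ^ 2) * (2 * x⁻¹ ^ 3)) x := by
      have := (((hasDerivAt_inv hx).pow 2).neg).exp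
      convert! this using 1
      simp
      field_simp
    have := (((p.hasDerivAt x⁻¹).comp x (hasDerivAt_inv hx)).mul he).const_mul (s x)
    convert! this.congr_of_eventuallyEq _ using 1
    · have : flatExp x = Real.exp (-(x⁻¹) ^ 2) := by
        rw [flatExp, if_neg hx]
        congr 1
        field_simp
      rw [this]
      simp
      ring_nf
      simp
    · filter_upwards [hs x hx, isOpen_ne.mem_nhds hx] with y hy hy0
      have : flatExp y = Real.exp (-(y⁻¹) ^ 2) := by
        rw [flatExp, if_neg hy0]
        congr 1
        field_simp
      simp [hy, this]

open Filter Topology Polynomial in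
lemma flat_contDiff (s : ℝ → ℝ) (hs : ∀ u ≠ 0, ∀ᶠ v in 𝓝 u, s v = s u)
    (hb : ∀ u, |s u| ≤ 1) {n : ℕ∞} (p : ℝ[X]) :
    ContDiff ℝ n (fun u : ℝ => s u * (p.eval u⁻¹ * flatExp u)) := by
  have hd : ∀ p : ℝ[X], Differentiable ℝ (fun u : ℝ => s u * (p.eval u⁻¹ * flatExp u)) :=
    fun p x => (flat_hasDerivAt s hs hb p x).differentiableAt
  apply contDiff_all_iff_nat.2 (fun m => ?_) n
  induction m generalizing p with
  | zero => exact contDiff_zero.2 (hd p).continuous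
  | succ m ihm =>
    rw [show ((m + 1 : ℕ) : WithTop ℕ∞) = m + 1 from rfl]
    refine contDiff_succ_iff_deriv.2 ⟨hd p, by simp, ?_⟩
    convert! ihm (2 * X ^ 3 * p - X ^ 2 * derivative p) using 2
    exact (flat_hasDerivAt s hs hb p _).deriv

open Filter Topology in
lemma sign_loc (u : ℝ) (hu : u ≠ 0) : ∀ᶠ v in 𝓝 u, Real.sign v = Real.sign u := by
  rcases lt_or_gt_of_ne hu with h | h
  · filter_upwards [gt_mem_nhds h] with v hv
    rw [Real.sign_of_neg h, Real.sign_of_neg hv]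
  · filter_upwards [lt_mem_nhds h] with v hv
    rw [Real.sign_of_pos h, Real.sign_of_pos hv]

lemma flatExp_ne (u : ℝ) (hu : u ≠ 0) : flatExp u ≠ 0 := by
  rw [flatExp, if_neg hu]
  exact (Real.exp_pos _).ne'

/-- The standard rotation action of SO(2) on ℝ² is not strict:
the plots `P(u) = (0, e^{-1/u²})` and `Q(u) = (0, sign(u)·e^{-1/u²})` are smooth,
`Q(u)` lies in the SO(2)-orbit of `P(u)` for every `u`, yet there is no neighborhood
`V` of `0` and smooth map `R : V → SO(2)` with `Q(u) = R(u)·P(u)` on `V`. -/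
theorem so2_action_not_strict :
    ContDiff ℝ (⊤ : ℕ∞) plotP ∧ ContDiff ℝ (⊤ : ℕ∞) plotQ ∧
      (∀ u : ℝ, ∃ M : Matrix (Fin 2) (Fin 2) ℝ, IsSO2 M ∧ M.mulVec (plotP u) = plotQ u) ∧
      ¬ ∃ (V : Set ℝ), V ∈ nhds (0 : ℝ) ∧
        ∃ R : ℝ → Matrix (Fin 2) (Fin 2) ℝ,
          (∀ i j : Fin 2, ContDiffOn ℝ (⊤ : ℕ∞) (fun u => R u i j) V) ∧
          (∀ u ∈ V, IsSO2 (R u)) ∧ ∀ u ∈ V, (R u).mulVec (plotP u) = plotQ u := by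
  refine ⟨?_, ?_, ?_, ?_⟩
  · rw [contDiff_pi]
    intro i
    fin_cases i
    · simpa [plotP] using contDiff_const
    · simpa [plotP] using flat_contDiff (fun _ => 1) (by simp) (by simp) (n := ⊤) 1
  · rw [contDiff_pi]
    intro i
    fin_cases i
    · simpa [plotQ] using contDiff_const
    · have hb : ∀ u : ℝ, |Real.sign u| ≤ 1 := fun u => by
        rcases Real.sign_apply_eq u with h | h | h <;> simp [h]
      simpa [plotQ] using flat_contDiff Real.sign sign_loc hb (n := ⊤) 1
  · intro u
    rcases lt_trichotomy u 0 with h | h | h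
    · refine ⟨-1, ⟨by simp, by simp [Matrix.det_fin_two]⟩, ?_⟩
      simp [plotP, plotQ, Real.sign_of_neg h, Matrix.neg_mulVec]
    · refine ⟨1, ⟨by simp, by simp⟩, ?_⟩
      simp [plotP, plotQ, h, flatExp]
    · refine ⟨1, ⟨by simp, by simp⟩, ?_⟩
      simp [plotP, plotQ, Real.sign_of_pos h]
  · rintro ⟨V, hV, R, hR, -, hQ⟩
    have hc : Filter.Tendsto (fun u => R u 1 1) (nhds 0) (nhds (R 0 1 1)) :=
      ((hR 1 1).continuousOn.continuousAt hV)
    have key : ∀ u ∈ V, u ≠ 0 → R u 1 1 = Real.sign u := by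
      intro u hu h0
      have := congrFun (hQ u hu) 1
      simp [plotP, plotQ, Matrix.mulVec, dotProduct, Fin.sum_univ_two] at this
      rcases this with h | h
      · exact h
      · exact absurd h (flatExp_ne u h0)
    have h1 : R 0 1 1 = 1 := by
      refine tendsto_nhds_unique_of_eventuallyEq
        (hc.mono_left (nhdsWithin_le_nhds (s := Set.Ioi 0))) tendsto_const_nhds ?_
      filter_upwards [self_mem_nhdsWithin, nhdsWithin_le_nhds hV] with u hu huV
      rw [key u huV (ne_of_gt hu), Real.sign_of_pos hu]
    have h2 : R 0 1 1 = -1 := by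
      refine tendsto_nhds_unique_of_eventuallyEq
        (hc.mono_left (nhdsWithin_le_nhds (s := Set.Iio 0))) tendsto_const_nhds ?_
      filter_upwards [self_mem_nhdsWithin, nhdsWithin_le_nhds hV] with u hu huV
      rw [key u huV (ne_of_lt hu), Real.sign_of_neg hu]
    linarith
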